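/- arXiv:1403.1388 — 7 statements merged into one kernel-verified Lean document; each statement's English description precedes it below -/
import Mathlib

section
/- Let s be a natural C² cubic spline with knots t_1 < ... < t_{n+1}. For every twice continuously differentiable function f : [t_1, t_{n+1}] → ℝ with f(t_i) = s(t_i) for all i = 1,...,n+1, one has ∫_{t_1}^{t_{n+1}} |s''(t)|² dt ≤ ∫_{t_1}^{t_{n+1}} |f''(t)|² dt, with equality if and only if f = s. -/
open Set MeasureTheory

/-- A C² cubic spline with knots `t 0 < t 1 < ... < t n` (i.e. t₁ < ... < t_{n+1}). -/
def IsCubicSpline (n : ℕ) (t : Fin (n + 1) → ℝ) (s : ℝ → ℝ) : Prop :=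
  ContDiffOn ℝ 2 s (Set.Icc (t 0) (t (Fin.last n))) ∧
  ∀ i : Fin n, ∃ p : Polynomial ℝ, p.natDegree ≤ 3 ∧
    ∀ x ∈ Set.Icc (t i.castSucc) (t i.succ), s x = Polynomial.eval x p

/-- A `C²` function on an interval has a continuous second derivative there, and its first
derivative is differentiable with that derivative. -/
theorem ContDiffOn.hasDerivWithinAt_Icc_two {u : ℝ → ℝ} {a b : ℝ} (hab : a < b)
    (hu : ContDiffOn ℝ 2 u (Icc a b)) :
    (∀ x ∈ Icc a b, HasDerivWithinAt u (derivWithin u (Icc a b) x) (Icc a b) x) ∧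
    (∀ x ∈ Icc a b, HasDerivWithinAt (derivWithin u (Icc a b))
      (iteratedDerivWithin 2 u (Icc a b) x) (Icc a b) x) ∧
    ContinuousOn (iteratedDerivWithin 2 u (Icc a b)) (Icc a b) := by
  have hI : UniqueDiffOn ℝ (Icc a b) := uniqueDiffOn_Icc hab
  refine ⟨fun x hx => (hu.differentiableOn (by norm_num) x hx).hasDerivWithinAt, fun x hx => ?_,
    hu.continuousOn_iteratedDerivWithin (by norm_num) hI⟩
  have h1 : DifferentiableOn ℝ (derivWithin u (Icc a b)) (Icc a b) :=
    (hu.derivWithin hI (m := 1) (by norm_num)).differentiableOn (by norm_num)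
  have h2 : iteratedDerivWithin 2 u (Icc a b) x =
      derivWithin (derivWithin u (Icc a b)) (Icc a b) x := by
    rw [iteratedDerivWithin_succ, iteratedDerivWithin_one]
  rw [h2]
  exact (h1 x hx).hasDerivWithinAt

/-- If `u` agrees with a polynomial on a subinterval, so does its second derivative. -/
theorem ContDiffOn.iteratedDerivWithin_two_eq_eval {u : ℝ → ℝ} {a b c d : ℝ} (hab : a < b)
    (hcd : c < d) (hsub : Icc c d ⊆ Icc a b) (hu : ContDiffOn ℝ 2 u (Icc a b))
    (p : Polynomial ℝ) (hp : ∀ x ∈ Icc c d, u x = p.eval x) :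
    ∀ x ∈ Icc c d, iteratedDerivWithin 2 u (Icc a b) x = p.derivative.derivative.eval x := by
  intro x hx
  have hJ : UniqueDiffOn ℝ (Icc c d) := uniqueDiffOn_Icc hcd
  have h1 : iteratedDerivWithin 2 u (Icc a b) x = iteratedDerivWithin 2 u (Icc c d) x := by
    simp only [iteratedDerivWithin]
    rw [iteratedFDerivWithin_subset hsub hJ (uniqueDiffOn_Icc hab) hu hx]
  have hpoly : ContDiff ℝ 2 (fun y => p.eval y) := by
    simpa [Polynomial.coe_aeval_eq_eval] using p.contDiff_aeval (𝕜 := ℝ) 2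
  rw [h1, iteratedDerivWithin_congr (g := fun y => p.eval y) hp hx,
    iteratedDerivWithin_eq_iteratedDeriv hJ hpoly.contDiffAt hx, iteratedDeriv_succ,
    iteratedDeriv_one]
  have h2 : deriv (fun y => p.eval y) = fun y => p.derivative.eval y := by
    ext y
    exact p.deriv
  rw [h2]
  exact p.derivative.deriv

/-- Integration by parts against the second derivative of a cubic, for a function vanishing at
both endpoints. -/
theorem integral_eval_derivative_derivative_mul {h h' h'' : ℝ → ℝ} {c d : ℝ} (hcd : c ≤ d)
    (p : Polynomial ℝ) (hp : p.natDegree ≤ 3)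
    (h1 : ∀ x ∈ Icc c d, HasDerivWithinAt h (h' x) (Icc c d) x)
    (h2 : ∀ x ∈ Icc c d, HasDerivWithinAt h' (h'' x) (Icc c d) x)
    (hcont : ContinuousOn h'' (Icc c d)) (hc : h c = 0) (hd : h d = 0) :
    ∫ x in c..d, p.derivative.derivative.eval x * h'' x =
      p.derivative.derivative.eval d * h' d - p.derivative.derivative.eval c * h' c := by
  set q := p.derivative.derivative with hq
  have hq2 : q.derivative.derivative = 0 := by
    exact Polynomial.iterate_derivative_eq_zero (p := p) (x := 4) (by omega)
  have key : ∀ x ∈ Icc c d, HasDerivWithinAt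
      (fun x => q.eval x * h' x - q.derivative.eval x * h x) (q.eval x * h'' x) (Icc c d) x := by
    intro x hx
    have := ((q.hasDerivAt x).hasDerivWithinAt.mul (h2 x hx)).sub
      ((q.derivative.hasDerivAt x).hasDerivWithinAt.mul (h1 x hx))
    refine this.congr_deriv ?_
    rw [hq2, Polynomial.eval_zero]
    ring
  rw [intervalIntegral.integral_eq_sub_of_hasDerivAt_of_le hcd
    (f := fun x => q.eval x * h' x - q.derivative.eval x * h x)
    (fun x hx => (key x hx).continuousWithinAt)
    (fun x hx => (key x (Ioo_subset_Icc_self hx)).hasDerivAt (Icc_mem_nhds hx.1 hx.2))]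
  · simp [hc, hd]
  · refine ContinuousOn.intervalIntegrable ?_
    rw [uIcc_of_le hcd]
    exact q.continuous.continuousOn.mul hcont

/-- The second derivative of a natural cubic spline is `L²`-orthogonal to that of every `C²`
function vanishing at the knots. -/
theorem IsCubicSpline.integral_mul_eq_zero {n : ℕ} (hn : 1 ≤ n) {t : Fin (n + 1) → ℝ}
    (ht : StrictMono t) {s : ℝ → ℝ} (hs : IsCubicSpline n t s)
    (hnat1 : iteratedDerivWithin 2 s (Icc (t 0) (t (Fin.last n))) (t 0) = 0)
    (hnat2 : iteratedDerivWithin 2 s (Icc (t 0) (t (Fin.last n))) (t (Fin.last n)) = 0)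
    {h : ℝ → ℝ} (hh : ContDiffOn ℝ 2 h (Icc (t 0) (t (Fin.last n)))) (hzero : ∀ i, h (t i) = 0) :
    ∫ x in (t 0)..(t (Fin.last n)), iteratedDerivWithin 2 s (Icc (t 0) (t (Fin.last n))) x *
      iteratedDerivWithin 2 h (Icc (t 0) (t (Fin.last n))) x = 0 := by
  have hab : t 0 < t (Fin.last n) := ht (by simp [Fin.lt_def]; omega)
  set I := Icc (t 0) (t (Fin.last n)) with hI
  have hmem : ∀ i, t i ∈ I := fun i => ⟨ht.monotone (Fin.zero_le i), ht.monotone (Fin.le_last i)⟩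
  obtain ⟨h1, h2, h3⟩ := hh.hasDerivWithinAt_Icc_two hab
  have hcont : ContinuousOn (fun x => iteratedDerivWithin 2 s I x * iteratedDerivWithin 2 h I x) I :=
    (hs.1.hasDerivWithinAt_Icc_two hab).2.2.mul h3
  have hint : ∀ i j, IntervalIntegrable
      (fun x => iteratedDerivWithin 2 s I x * iteratedDerivWithin 2 h I x) volume (t i) (t j) :=
    fun i j => (hcont.mono (OrdConnected.uIcc_subset ordConnected_Icc (hmem i)
      (hmem j))).intervalIntegrable
  have key : ∀ i, ∫ x in (t 0)..(t i), iteratedDerivWithin 2 s I x * iteratedDerivWithin 2 h I x =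
      iteratedDerivWithin 2 s I (t i) * derivWithin h I (t i) := by
    intro i
    induction i using Fin.induction with
    | zero => simp [hnat1]
    | succ i ih =>
      have hcd : t i.castSucc < t i.succ := ht Fin.castSucc_lt_succ
      have hsub : Icc (t i.castSucc) (t i.succ) ⊆ I := Icc_subset_Icc (hmem _).1 (hmem _).2
      obtain ⟨p, hp, hsp⟩ := hs.2 i
      have hs2 := hs.1.iteratedDerivWithin_two_eq_eval hab hcd hsub p hsp
      rw [← intervalIntegral.integral_add_adjacent_intervals (hint 0 i.castSucc) (hint _ i.succ),
        ih, intervalIntegral.integral_congr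
          (g := fun x => p.derivative.derivative.eval x * iteratedDerivWithin 2 h I x),
        integral_eval_derivative_derivative_mul hcd.le p hp
          (fun x hx => (h1 x (hsub hx)).mono hsub) (fun x hx => (h2 x (hsub hx)).mono hsub)
          (h3.mono hsub) (hzero _) (hzero _),
        hs2 _ (left_mem_Icc.2 hcd.le), hs2 _ (right_mem_Icc.2 hcd.le)]
      · ring
      · intro x hx
        rw [uIcc_of_le hcd.le] at hx
        simp only [hI, hs2 x hx]
  rw [key, hnat2, zero_mul]

/-- A `C²` function with zero boundary values and `∫ |h''|² = 0` vanishes. -/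
theorem ContDiffOn.eqOn_zero_of_integral_sq_eq_zero {h : ℝ → ℝ} {a b : ℝ} (hab : a < b)
    (hh : ContDiffOn ℝ 2 h (Icc a b)) (ha : h a = 0) (hb : h b = 0)
    (hint : ∫ x in a..b, iteratedDerivWithin 2 h (Icc a b) x ^ 2 = 0) :
    EqOn h 0 (Icc a b) := by
  obtain ⟨h1, h2, h3⟩ := hh.hasDerivWithinAt_Icc_two hab
  have hI : UniqueDiffOn ℝ (Icc a b) := uniqueDiffOn_Icc hab
  have hsecond : ∀ x ∈ Icc a b, iteratedDerivWithin 2 h (Icc a b) x = 0 := by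
    by_contra! hne
    obtain ⟨x, hx, hx0⟩ := hne
    have := intervalIntegral.integral_pos hab (h3.pow 2) (fun y _ => sq_nonneg _)
      ⟨x, hx, sq_pos_of_ne_zero hx0⟩
    exact this.ne' hint
  have hfirst : ∀ x ∈ Icc a b, derivWithin h (Icc a b) x = derivWithin h (Icc a b) a :=
    constant_of_derivWithin_zero (fun x hx => (h2 x hx).differentiableWithinAt) fun x hx => by
      rw [(h2 x (Ico_subset_Icc_self hx)).derivWithin (hI x (Ico_subset_Icc_self hx)),
        hsecond x (Ico_subset_Icc_self hx)]
  set c := derivWithin h (Icc a b) a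
  have hlin : ∀ x ∈ Icc a b, HasDerivWithinAt (fun x => h x - c * x) 0 (Icc a b) x := by
    intro x hx
    refine ((h1 x hx).sub ((hasDerivWithinAt_id x _).const_mul c)).congr_deriv ?_
    rw [hfirst x hx]
    ring
  have hconst := constant_of_derivWithin_zero (fun x hx => (hlin x hx).differentiableWithinAt)
    fun x hx => (hlin x (Ico_subset_Icc_self hx)).derivWithin (hI x (Ico_subset_Icc_self hx))
  have hc : c = 0 := by
    have hcb := hconst b (right_mem_Icc.2 hab.le)
    have : c * (b - a) = 0 := by linarith
    exact (mul_eq_zero.1 this).resolve_right (sub_ne_zero.2 hab.ne')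
  intro x hx
  simpa [hc, ha] using hconst x hx

/-- Let s be a natural C² cubic spline with knots t_1 < ... < t_{n+1}.  For every
twice continuously differentiable f : [t_1, t_{n+1}] → ℝ with f(t_i) = s(t_i) for all i,
∫ |s''|² ≤ ∫ |f''|², with equality if and only if f = s. -/
theorem stmt2 (n : ℕ) (hn : 1 ≤ n) (t : Fin (n + 1) → ℝ) (ht : StrictMono t)
    (s : ℝ → ℝ) (hs : IsCubicSpline n t s)
    (hnat1 : iteratedDerivWithin 2 s (Set.Icc (t 0) (t (Fin.last n))) (t 0) = 0)
    (hnat2 : iteratedDerivWithin 2 s (Set.Icc (t 0) (t (Fin.last n))) (t (Fin.last n)) = 0)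
    (f : ℝ → ℝ) (hf : ContDiffOn ℝ 2 f (Set.Icc (t 0) (t (Fin.last n))))
    (hinterp : ∀ i, f (t i) = s (t i)) :
    (∫ x in (t 0)..(t (Fin.last n)),
        (iteratedDerivWithin 2 s (Set.Icc (t 0) (t (Fin.last n))) x) ^ 2) ≤
      (∫ x in (t 0)..(t (Fin.last n)),
        (iteratedDerivWithin 2 f (Set.Icc (t 0) (t (Fin.last n))) x) ^ 2) ∧
    ((∫ x in (t 0)..(t (Fin.last n)),
        (iteratedDerivWithin 2 s (Set.Icc (t 0) (t (Fin.last n))) x) ^ 2) =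
      (∫ x in (t 0)..(t (Fin.last n)),
        (iteratedDerivWithin 2 f (Set.Icc (t 0) (t (Fin.last n))) x) ^ 2) ↔
      Set.EqOn f s (Set.Icc (t 0) (t (Fin.last n)))) := by
  have hab : t 0 < t (Fin.last n) := ht (by simp [Fin.lt_def]; omega)
  have hh : ContDiffOn ℝ 2 (f - s) (Icc (t 0) (t (Fin.last n))) := hf.sub hs.1
  have horth := hs.integral_mul_eq_zero hn ht hnat1 hnat2 hh fun i => by simp [hinterp i]
  have hzero := hh.eqOn_zero_of_integral_sq_eq_zero hab (by simp [hinterp]) (by simp [hinterp])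
  have hS := (hs.1.hasDerivWithinAt_Icc_two hab).2.2
  have hH := (hh.hasDerivWithinAt_Icc_two hab).2.2
  set I := Icc (t 0) (t (Fin.last n)) with hI
  have hint : ∀ {g : ℝ → ℝ}, ContinuousOn g I →
      IntervalIntegrable g volume (t 0) (t (Fin.last n)) := fun hg =>
    ContinuousOn.intervalIntegrable (by rwa [uIcc_of_le hab.le])
  have hpyth : ∫ x in (t 0)..(t (Fin.last n)), iteratedDerivWithin 2 f I x ^ 2 =
      (∫ x in (t 0)..(t (Fin.last n)), iteratedDerivWithin 2 s I x ^ 2) +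
        ∫ x in (t 0)..(t (Fin.last n)), iteratedDerivWithin 2 (f - s) I x ^ 2 := by
    have hexp : ∫ x in (t 0)..(t (Fin.last n)), iteratedDerivWithin 2 f I x ^ 2 =
        ∫ x in (t 0)..(t (Fin.last n)), (iteratedDerivWithin 2 s I x ^ 2 +
          iteratedDerivWithin 2 (f - s) I x ^ 2 +
          2 * (iteratedDerivWithin 2 s I x * iteratedDerivWithin 2 (f - s) I x)) := by
      refine intervalIntegral.integral_congr fun x hx => ?_
      rw [uIcc_of_le hab.le] at hx
      have := iteratedDerivWithin_sub hx (uniqueDiffOn_Icc hab) (hf x hx) (hs.1 x hx)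
      simp only [hI, this]
      ring
    rw [hexp, intervalIntegral.integral_add (hint (by fun_prop)) (hint (by fun_prop)),
      intervalIntegral.integral_add (hint (by fun_prop)) (hint (by fun_prop)),
      intervalIntegral.integral_const_mul, horth]
    ring
  have hnonneg : 0 ≤ ∫ x in (t 0)..(t (Fin.last n)), iteratedDerivWithin 2 (f - s) I x ^ 2 :=
    intervalIntegral.integral_nonneg hab.le fun x _ => sq_nonneg _
  refine ⟨by linarith, fun heq x hx => ?_, fun heq => ?_⟩
  · exact sub_eq_zero.1 (hzero (by linarith) hx)
  · refine intervalIntegral.integral_congr fun x hx => ?_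
    rw [uIcc_of_le hab.le] at hx
    simp only [iteratedDerivWithin_congr heq hx]
end

section
/- Let g be a natural C² cubic spline with knots t_1 < ... < t_{n+1} and let s be a C² cubic spline with the same knots satisfying s(t_i) = 0 for all i = 1,...,n+1. Then ∫_{t_1}^{t_{n+1}} s''(t) g''(t) dt = 0. -/
open Set MeasureTheory

open Polynomial in
/-- Two integrations by parts on an interval where `p` vanishes at both ends and `q` is cubic. -/
theorem integral_derivative_derivative_mul_of_natDegree_le_three (p q : ℝ[X])
    (hq : q.natDegree ≤ 3) {a b : ℝ} (ha : p.eval a = 0) (hb : p.eval b = 0) :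
    ∫ x in a..b, p.derivative.derivative.eval x * q.derivative.derivative.eval x =
      p.derivative.eval b * q.derivative.derivative.eval b -
        p.derivative.eval a * q.derivative.derivative.eval a := by
  have hq4 : q.derivative.derivative.derivative.derivative = 0 :=
    iterate_derivative_eq_zero (x := 4) (by omega)
  set F := p.derivative * q.derivative.derivative - p * q.derivative.derivative.derivative with hF
  have hF' : F.derivative = p.derivative.derivative * q.derivative.derivative := by
    simp only [hF, derivative_sub, derivative_mul, hq4]
    ring
  have key := intervalIntegral.integral_eq_sub_of_hasDerivAt (a := a) (b := b)
    (fun x _ => F.hasDerivAt x) (F.derivative.continuous.intervalIntegrable a b)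
  rw [hF'] at key
  simpa [hF, ha, hb] using key

open Polynomial in
/-- A function agreeing with a polynomial on a subinterval has the polynomial's derivative there,
endpoints included. -/
theorem derivWithin_eq_eval_derivative_of_eqOn_Icc {f : ℝ → ℝ} {S : Set ℝ} {a b : ℝ} (hab : a < b)
    (hS : Icc a b ⊆ S) (hf : DifferentiableOn ℝ f S) {p : ℝ[X]}
    (hp : EqOn f (fun x => p.eval x) (Icc a b)) :
    EqOn (derivWithin f S) (fun x => p.derivative.eval x) (Icc a b) := by
  intro x hx
  have hfx := ((hf x (hS hx)).hasDerivWithinAt).mono hS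
  have hpx := ((p.hasDerivAt x).hasDerivWithinAt (s := Icc a b)).congr hp (hp hx)
  exact (uniqueDiffOn_Icc hab x hx).eq_deriv _ hfx hpx

open Polynomial in
theorem ContDiffOn.iteratedDerivWithin_two_eq_eval_of_eqOn_Icc {f : ℝ → ℝ} {S : Set ℝ}
    (hf : ContDiffOn ℝ 2 f S) (hSu : UniqueDiffOn ℝ S) {a b : ℝ} (hab : a < b)
    (hS : Icc a b ⊆ S) {p : ℝ[X]} (hp : EqOn f (fun x => p.eval x) (Icc a b)) :
    EqOn (iteratedDerivWithin 2 f S) (fun x => p.derivative.derivative.eval x) (Icc a b) := by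
  have h2 : iteratedDerivWithin 2 f S = derivWithin (derivWithin f S) S := by
    ext x
    rw [iteratedDerivWithin_eq_iterate]
    rfl
  rw [h2]
  have hd : DifferentiableOn ℝ (derivWithin f S) S :=
    (hf.derivWithin hSu (m := 1) (by norm_num)).differentiableOn (by norm_num)
  exact derivWithin_eq_eval_derivative_of_eqOn_Icc hab hS hd
    (derivWithin_eq_eval_derivative_of_eqOn_Icc hab hS (hf.differentiableOn (by norm_num)) hp)

/-- Let g be a natural C² cubic spline with knots t_1 < ... < t_{n+1} and let s be
a C² cubic spline with the same knots satisfying s(t_i) = 0 for all i.  Then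
∫_{t_1}^{t_{n+1}} s''(t) g''(t) dt = 0. -/
theorem stmt3 (n : ℕ) (hn : 1 ≤ n) (t : Fin (n + 1) → ℝ) (ht : StrictMono t)
    (g : ℝ → ℝ) (hg : IsCubicSpline n t g)
    (hnat1 : iteratedDerivWithin 2 g (Set.Icc (t 0) (t (Fin.last n))) (t 0) = 0)
    (hnat2 : iteratedDerivWithin 2 g (Set.Icc (t 0) (t (Fin.last n))) (t (Fin.last n)) = 0)
    (s : ℝ → ℝ) (hs : IsCubicSpline n t s) (hzero : ∀ i, s (t i) = 0) :
    ∫ x in (t 0)..(t (Fin.last n)),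
        (iteratedDerivWithin 2 s (Set.Icc (t 0) (t (Fin.last n))) x) *
          (iteratedDerivWithin 2 g (Set.Icc (t 0) (t (Fin.last n))) x) = 0 := by
  set S := Icc (t 0) (t (Fin.last n)) with hSdef
  have hlt : t 0 < t (Fin.last n) := ht (Fin.lt_def.2 hn)
  have hSu : UniqueDiffOn ℝ S := uniqueDiffOn_Icc hlt
  have hmem : ∀ k, t k ∈ S := fun k => ⟨ht.monotone k.zero_le, ht.monotone k.le_last⟩
  have hint : ∀ j k, IntervalIntegrable
      (fun x => iteratedDerivWithin 2 s S x * iteratedDerivWithin 2 g S x) volume (t j) (t k) :=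
    fun j k => (((hs.1.continuousOn_iteratedDerivWithin le_rfl hSu).mul
      (hg.1.continuousOn_iteratedDerivWithin le_rfl hSu)).mono
        (ordConnected_Icc.uIcc_subset (hmem j) (hmem k))).intervalIntegrable
  have key : ∀ k : Fin (n + 1),
      ∫ x in (t 0)..(t k), iteratedDerivWithin 2 s S x * iteratedDerivWithin 2 g S x =
        derivWithin s S (t k) * iteratedDerivWithin 2 g S (t k) := by
    intro k
    induction k using Fin.induction with
    | zero => simp [hnat1]
    | succ i ih =>
      obtain ⟨p, -, hp⟩ := hs.2 i
      obtain ⟨q, hq3, hq⟩ := hg.2 i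
      have hab : t i.castSucc < t i.succ := ht i.castSucc_lt_succ
      have hsub : Icc (t i.castSucc) (t i.succ) ⊆ S := Icc_subset_Icc (hmem _).1 (hmem _).2
      have hl := left_mem_Icc.2 hab.le
      have hr := right_mem_Icc.2 hab.le
      have hs1 := derivWithin_eq_eval_derivative_of_eqOn_Icc hab hsub
        (hs.1.differentiableOn (by norm_num)) hp
      have hs2 := hs.1.iteratedDerivWithin_two_eq_eval_of_eqOn_Icc hSu hab hsub hp
      have hg2 := hg.1.iteratedDerivWithin_two_eq_eval_of_eqOn_Icc hSu hab hsub hq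
      have hpiece := integral_derivative_derivative_mul_of_natDegree_le_three p q hq3
        ((hp _ hl).symm.trans (hzero _)) ((hp _ hr).symm.trans (hzero _))
      rw [← intervalIntegral.integral_add_adjacent_intervals (hint 0 i.castSucc)
        (hint i.castSucc i.succ), ih, intervalIntegral.integral_congr
          (g := fun x => p.derivative.derivative.eval x * q.derivative.derivative.eval x), hpiece,
        hs1 hl, hs1 hr, hg2 hl, hg2 hr]
      · ring
      · intro x hx
        rw [uIcc_of_le hab.le] at hx
        exact congrArg₂ (· * ·) (hs2 hx) (hg2 hx)
  rw [key, hnat2, mul_zero]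
end

section
/- Let M be an (n+1)×(n+1) symmetric positive semidefinite real matrix, L an (n+1)×2 real matrix of rank 2 with ML = 0, and λ > 0. Then (I + λM)^{-1} L = L. If moreover the kernel of M equals the range R(L) of L, then for every y ∈ ℝ^{n+1} the vectors L(LᵀL)^{-1}Lᵀ y and [(I + λM)^{-1} − L(LᵀL)^{-1}Lᵀ] y are orthogonal. -/
open Matrix

namespace Matrix

variable {m k : Type*} [Fintype m]

/-- The inverse of `1 + c • M` fixes every matrix that `M` annihilates. -/
theorem inv_one_add_smul_mul_of_mul_eq_zero [DecidableEq m] {M : Matrix m m ℝ} (hM : M.PosSemidef)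
    {L : Matrix m k ℝ} (hML : M * L = 0) {c : ℝ} (hc : 0 ≤ c) :
    (1 + c • M)⁻¹ * L = L := by
  have hdet : IsUnit (1 + c • M).det :=
    (isUnit_iff_isUnit_det _).mp (PosDef.one.add_posSemidef (hM.smul hc)).isUnit
  have hL : (1 + c • M) * L = L := by
    rw [Matrix.add_mul, Matrix.one_mul, Matrix.smul_mul, hML, smul_zero, add_zero]
  conv_lhs => rw [← hL]
  exact nonsing_inv_mul_cancel_left _ _ hdet

theorem transpose_mul_inv_gram_mul_transpose [Fintype k] [DecidableEq k] (L : Matrix m k ℝ) :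
    (L * (Lᵀ * L)⁻¹ * Lᵀ)ᵀ = L * (Lᵀ * L)⁻¹ * Lᵀ := by
  simp only [transpose_mul, transpose_nonsing_inv, transpose_transpose, Matrix.mul_assoc]

theorem isUnit_det_transpose_mul_self_of_rank_eq_card [Fintype k] [DecidableEq k]
    {L : Matrix m k ℝ}
    (hL : L.rank = Fintype.card k) : IsUnit (Lᵀ * L).det := by
  rw [← isUnit_iff_isUnit_det, ← linearIndependent_cols_iff_isUnit,
    linearIndependent_iff_card_eq_finrank_span, Set.finrank, ← rank_eq_finrank_span_cols,
    rank_transpose_mul_self, hL]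

theorem isIdempotentElem_mul_inv_gram_mul_transpose [Fintype k] [DecidableEq k]
    {L : Matrix m k ℝ} (hL : L.rank = Fintype.card k) : IsIdempotentElem (L * (Lᵀ * L)⁻¹ * Lᵀ) := by
  have h := nonsing_inv_mul (Lᵀ * L) (isUnit_det_transpose_mul_self_of_rank_eq_card hL)
  calc L * (Lᵀ * L)⁻¹ * Lᵀ * (L * (Lᵀ * L)⁻¹ * Lᵀ)
      = L * ((Lᵀ * L)⁻¹ * (Lᵀ * L)) * (Lᵀ * L)⁻¹ * Lᵀ := by simp only [Matrix.mul_assoc]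
    _ = L * (Lᵀ * L)⁻¹ * Lᵀ := by rw [h, Matrix.mul_one]

end Matrix

/-- Let M be (n+1)×(n+1) symmetric positive semidefinite, L an (n+1)×2 matrix of
rank 2 with ML = 0, λ > 0.  Then (I + λM)⁻¹L = L.  If moreover ker M = R(L), then for every
y ∈ ℝ^{n+1} the vectors L(LᵀL)⁻¹Lᵀ y and [(I + λM)⁻¹ − L(LᵀL)⁻¹Lᵀ] y are orthogonal. -/
theorem stmt9 (n : ℕ) (hn : 1 ≤ n)
    (M : Matrix (Fin (n + 1)) (Fin (n + 1)) ℝ) (hM : M.PosSemidef)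
    (L : Matrix (Fin (n + 1)) (Fin 2) ℝ) (hL : L.rank = 2) (hML : M * L = 0)
    (lam : ℝ) (hlam : 0 < lam) :
    (1 + lam • M)⁻¹ * L = L ∧
    (LinearMap.ker M.mulVecLin = LinearMap.range L.mulVecLin →
      ∀ y : Fin (n + 1) → ℝ,
        ((L * (Lᵀ * L)⁻¹ * Lᵀ) *ᵥ y) ⬝ᵥ
          (((1 + lam • M)⁻¹ - L * (Lᵀ * L)⁻¹ * Lᵀ) *ᵥ y) = 0) := by
  have hHL : (1 + lam • M)⁻¹ * L = L := inv_one_add_smul_mul_of_mul_eq_zero hM hML hlam.le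
  refine ⟨hHL, fun _ y => ?_⟩
  have hP := isIdempotentElem_mul_inv_gram_mul_transpose (hL.trans (Fintype.card_fin 2).symm)
  have hPt := transpose_mul_inv_gram_mul_transpose L
  have hHP : (1 + lam • M)⁻¹ * (L * (Lᵀ * L)⁻¹ * Lᵀ) = L * (Lᵀ * L)⁻¹ * Lᵀ := by
    simp only [← Matrix.mul_assoc, hHL]
  have hMt : Mᵀ = M := by simpa using hM.isHermitian.eq
  have hHt : ((1 + lam • M)⁻¹)ᵀ = (1 + lam • M)⁻¹ := by
    rw [transpose_nonsing_inv, transpose_add, transpose_one, transpose_smul, hMt]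
  rw [dotProduct_comm, ← vecMul_transpose, ← dotProduct_mulVec, mulVec_mulVec,
    transpose_sub, hHt, hPt, Matrix.sub_mul, hHP, hP.eq, sub_self, zero_mulVec, dotProduct_zero]
end

section
/- Let M be an (n+1)×(n+1) symmetric positive semidefinite real matrix, y ∈ ℝ^{n+1}, π the orthogonal projection of ℝ^{n+1} onto the kernel of M, and define ψ(λ) = ‖y − (I + λM)^{-1} y‖² for λ > 0. Then ψ is continuous and nondecreasing on (0, +∞), ψ(λ) ≤ ‖y − πy‖² for all λ > 0, ψ(λ) → 0 as λ → 0+, ψ(λ) → ‖y − πy‖² as λ → +∞, and consequently for every real number c with 0 < c < ‖y − πy‖² there exists λ > 0 such that ψ(λ) = c. -/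
open Matrix Filter Topology

/-- ψ(λ) = ‖y − (I + λM)⁻¹y‖² (squared Euclidean norm). -/
noncomputable def psi10 (n : ℕ) (M : Matrix (Fin (n + 1)) (Fin (n + 1)) ℝ)
    (y : Fin (n + 1) → ℝ) (lam : ℝ) : ℝ :=
  ∑ i, (y i - ((1 + lam • M)⁻¹ *ᵥ y) i) ^ 2

/-- A positive semidefinite real matrix has an eigenvector family satisfying Parseval's identity. -/
theorem Matrix.PosSemidef.exists_eigenvectors_parseval {ι : Type*} [Fintype ι]
    {M : Matrix ι ι ℝ} (hM : M.PosSemidef) :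
    ∃ (v : ι → ι → ℝ) (μ : ι → ℝ), (∀ j, 0 ≤ μ j) ∧ (∀ j, M *ᵥ v j = μ j • v j) ∧
      ∀ w : ι → ℝ, ∑ i, w i ^ 2 = ∑ j, (v j ⬝ᵥ w) ^ 2 := by
  classical
  refine ⟨fun j => hM.isHermitian.eigenvectorBasis j, hM.isHermitian.eigenvalues,
    hM.eigenvalues_nonneg, hM.isHermitian.mulVec_eigenvectorBasis, fun w => ?_⟩
  have h := hM.isHermitian.eigenvectorBasis.sum_sq_norm_inner_right (WithLp.toLp 2 w)
  rw [EuclideanSpace.norm_sq_eq] at h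
  simpa [EuclideanSpace.inner_eq_star_dotProduct, dotProduct_comm] using h.symm

theorem Matrix.PosSemidef.dotProduct_mulVec_of_eigenvector {ι : Type*} [Fintype ι]
    {M : Matrix ι ι ℝ} (hM : M.PosSemidef) {v : ι → ℝ} {μ : ℝ} (hv : M *ᵥ v = μ • v)
    (x : ι → ℝ) : v ⬝ᵥ (M *ᵥ x) = μ * (v ⬝ᵥ x) := by
  have hT : Mᵀ = M := by simpa using hM.isHermitian.eq
  rw [dotProduct_mulVec, ← mulVec_transpose, hT, hv, smul_dotProduct, smul_eq_mul]

theorem Matrix.PosSemidef.dotProduct_sub_resolvent_mulVec {ι : Type*} [Fintype ι] [DecidableEq ι]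
    {M : Matrix ι ι ℝ} (hM : M.PosSemidef) {v : ι → ℝ} {μ : ℝ} (hμ : 0 ≤ μ)
    (hv : M *ᵥ v = μ • v) (y : ι → ℝ) {t : ℝ} (ht : 0 < t) :
    v ⬝ᵥ (y - (1 + t • M)⁻¹ *ᵥ y) = t * μ / (1 + t * μ) * (v ⬝ᵥ y) := by
  have hunit : IsUnit (1 + t • M).det :=
    (Matrix.isUnit_iff_isUnit_det _).1 (PosDef.one.add_posSemidef (hM.smul ht.le)).isUnit
  set x := (1 + t • M)⁻¹ *ᵥ y with hx
  have hxy : x + t • (M *ᵥ x) = y := by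
    have h : (1 + t • M) *ᵥ x = y := by
      rw [hx, mulVec_mulVec, mul_nonsing_inv _ hunit, one_mulVec]
    rwa [add_mulVec, one_mulVec, smul_mulVec] at h
  have h := congrArg (v ⬝ᵥ ·) hxy
  simp only [dotProduct_add, dotProduct_smul, smul_eq_mul,
    hM.dotProduct_mulVec_of_eigenvector hv] at h
  have hpos : 1 + t * μ ≠ 0 := by positivity
  rw [dotProduct_sub]
  field_simp
  rw [← h]
  ring

theorem monotoneOn_mul_div_one_add_mul {μ : ℝ} (hμ : 0 ≤ μ) :
    MonotoneOn (fun t : ℝ => t * μ / (1 + t * μ)) (Set.Ici 0) := by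
  intro s hs t ht hst
  have hs' : 0 ≤ s := hs
  have ht' : 0 ≤ t := ht
  simp only
  rw [div_le_div_iff₀ (by positivity) (by positivity)]
  nlinarith [mul_le_mul_of_nonneg_right hst hμ]

theorem continuousOn_mul_div_one_add_mul {μ : ℝ} (hμ : 0 ≤ μ) :
    ContinuousOn (fun t : ℝ => t * μ / (1 + t * μ)) (Set.Ici 0) := by
  refine ContinuousOn.div (by fun_prop) (by fun_prop) fun t ht => ?_
  have ht' : 0 ≤ t := ht
  positivity

theorem tendsto_mul_div_one_add_mul_atTop {μ : ℝ} (hμ : 0 < μ) :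
    Tendsto (fun t : ℝ => t * μ / (1 + t * μ)) atTop (𝓝 1) := by
  have h : Tendsto (fun t : ℝ => 1 - (1 + t * μ)⁻¹) atTop (𝓝 (1 - 0)) :=
    tendsto_const_nhds.sub (tendsto_inv_atTop_zero.comp
      (tendsto_atTop_add_const_left _ _ (tendsto_id.atTop_mul_const hμ)))
  rw [sub_zero] at h
  refine h.congr' ?_
  filter_upwards [eventually_ge_atTop 0] with t ht
  have : 1 + t * μ ≠ 0 := by positivity
  field_simp
  ring

/-- Let M be (n+1)×(n+1) symmetric positive semidefinite, y ∈ ℝ^{n+1}, π the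
orthogonal projection onto ker M (here characterized by: q = πy lies in ker M and y − q is
orthogonal to ker M), and ψ(λ) = ‖y − (I + λM)⁻¹y‖².  Then ψ is continuous and nondecreasing
on (0, ∞), ψ(λ) ≤ ‖y − πy‖², ψ(λ) → 0 as λ → 0+, ψ(λ) → ‖y − πy‖² as λ → +∞, and for each
c with 0 < c < ‖y − πy‖² there is λ > 0 with ψ(λ) = c. -/
theorem stmt10 (n : ℕ) (hn : 1 ≤ n)
    (M : Matrix (Fin (n + 1)) (Fin (n + 1)) ℝ) (hM : M.PosSemidef)
    (y q : Fin (n + 1) → ℝ)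
    (hq1 : M *ᵥ q = 0)
    (hq2 : ∀ z : Fin (n + 1) → ℝ, M *ᵥ z = 0 → (y - q) ⬝ᵥ z = 0) :
    ContinuousOn (psi10 n M y) (Set.Ioi 0) ∧
    MonotoneOn (psi10 n M y) (Set.Ioi 0) ∧
    (∀ lam : ℝ, 0 < lam → psi10 n M y lam ≤ ∑ i, (y i - q i) ^ 2) ∧
    Tendsto (psi10 n M y) (𝓝[>] 0) (𝓝 0) ∧
    Tendsto (psi10 n M y) atTop (𝓝 (∑ i, (y i - q i) ^ 2)) ∧
    (∀ c : ℝ, 0 < c → c < ∑ i, (y i - q i) ^ 2 →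
      ∃ lam : ℝ, 0 < lam ∧ psi10 n M y lam = c) := by
  obtain ⟨v, μ, hμ, hv, hpars⟩ := hM.exists_eigenvectors_parseval
  set φ : ℝ → ℝ := fun t => ∑ j, (t * μ j / (1 + t * μ j) * (v j ⬝ᵥ y)) ^ 2 with hφ
  have heq : Set.EqOn (psi10 n M y) φ (Set.Ioi 0) := by
    intro t ht
    refine (hpars (y - (1 + t • M)⁻¹ *ᵥ y)).trans (Finset.sum_congr rfl fun j _ => ?_)
    rw [hM.dotProduct_sub_resolvent_mulVec (hμ j) (hv j) y ht]
  have hproj : ∀ j, v j ⬝ᵥ (y - q) = if μ j = 0 then 0 else v j ⬝ᵥ y := by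
    intro j
    split_ifs with h
    · rw [dotProduct_comm]
      exact hq2 _ (by rw [hv, h, zero_smul])
    · have hq := hM.dotProduct_mulVec_of_eigenvector (hv j) q
      rw [hq1, dotProduct_zero, eq_comm, mul_eq_zero, or_iff_right h] at hq
      rw [dotProduct_sub, hq, sub_zero]
  have hlim : ∑ i, (y i - q i) ^ 2 = ∑ j, (v j ⬝ᵥ (y - q)) ^ 2 := hpars (y - q)
  have hφcont : ContinuousOn φ (Set.Ici 0) := continuousOn_finsetSum _ fun j _ =>
    ((continuousOn_mul_div_one_add_mul (hμ j)).mul continuousOn_const).pow 2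
  have hcont : ContinuousOn (psi10 n M y) (Set.Ioi 0) :=
    (hφcont.mono Set.Ioi_subset_Ici_self).congr heq
  have hmono : MonotoneOn (psi10 n M y) (Set.Ioi 0) := by
    intro s hs t ht hst
    rw [heq hs, heq ht]
    refine Finset.sum_le_sum fun j _ => ?_
    have hs' : 0 < s := hs
    have hj := hμ j
    rw [mul_pow, mul_pow]
    gcongr ?_ ^ 2 * _
    exact monotoneOn_mul_div_one_add_mul hj hs'.le (hs'.le.trans hst) hst
  have hzero : Tendsto (psi10 n M y) (𝓝[>] 0) (𝓝 0) := by
    have h := (hφcont 0 Set.self_mem_Ici).mono_left (nhdsWithin_mono 0 Set.Ioi_subset_Ici_self)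
    have h0 : φ 0 = 0 := by simp [hφ]
    rw [h0] at h
    exact h.congr' (heq.symm.eventuallyEq_of_mem self_mem_nhdsWithin)
  have htop : Tendsto (psi10 n M y) atTop (𝓝 (∑ i, (y i - q i) ^ 2)) := by
    rw [hlim]
    refine Tendsto.congr' (heq.symm.eventuallyEq_of_mem (Ioi_mem_atTop 0))
      (tendsto_finsetSum _ fun j _ => Tendsto.pow ?_ 2)
    rw [hproj]
    split_ifs with h
    · simp [h]
    · simpa using (tendsto_mul_div_one_add_mul_atTop ((hμ j).lt_of_ne' h)).mul_const (v j ⬝ᵥ y)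
  refine ⟨hcont, hmono, fun t ht => ?_, hzero, htop, fun c hc hc' => ?_⟩
  · refine ge_of_tendsto htop ?_
    filter_upwards [eventually_ge_atTop t] with s hs
    exact hmono ht (ht.trans_le hs) hs
  · obtain ⟨s, hsc, hs⟩ := ((hzero.eventually_lt_const hc).and self_mem_nhdsWithin).exists
    obtain ⟨t, htc, ht⟩ := ((htop.eventually_const_lt hc').and (eventually_gt_atTop 0)).exists
    obtain ⟨r, hr, hrc⟩ := isPreconnected_Ioi.intermediate_value hs ht hcont ⟨hsc.le, htc.le⟩
    exact ⟨r, hr, hrc⟩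
end

section
/- Let p ∈ ℝ^{n+1}, let w be a random vector in ℝ^{n+1} with E[w] = 0 and E[w wᵀ] = σ² I, set y = p + w, and let H be any fixed (n+1)×(n+1) real matrix. Then the mean square risk satisfies E[‖H y − p‖²] = E[‖y − H y‖² + 2σ² Trace(H) − (n+1)σ²]; i.e. RSS + 2σ² Trace(H) − (n+1)σ², with RSS = ‖y − H y‖², is an unbiased estimate of the risk E[‖H y − p‖²] (Stein's Unbiased Risk Estimate). -/
open Matrix MeasureTheory

theorem memLp_mulVec_apply {ι κ Ω : Type*} [Fintype ι] [MeasurableSpace Ω] {μ : Measure Ω}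
    {q : ENNReal} {y : Ω → ι → ℝ} (hy : ∀ i, MemLp (fun ω => y ω i) q μ)
    (A : Matrix κ ι ℝ) (i : κ) : MemLp (fun ω => (A *ᵥ y ω) i) q μ := by
  simp only [mulVec, dotProduct]
  exact memLp_finsetSum _ fun j _ => (hy j).const_mul (A i j)

/-- The squared error of the linear estimate `H (p + w)` of `p` exceeds its residual sum of squares
by an explicit quadratic polynomial in the noise `w`. -/
theorem sum_sq_mulVec_sub_eq {ι : Type*} [Fintype ι] (H : Matrix ι ι ℝ) (p w : ι → ℝ) :
    ∑ i, ((H *ᵥ (p + w)) i - p i) ^ 2 =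
      ∑ i, ((p + w) i - (H *ᵥ (p + w)) i) ^ 2 +
        ∑ i, (2 * ((H *ᵥ p) i - p i) * w i + ∑ j, 2 * H i j * (w i * w j) - w i * w i) := by
  rw [← Finset.sum_add_distrib]
  refine Finset.sum_congr rfl fun i _ => ?_
  have h : ∑ j, 2 * H i j * (w i * w j) = 2 * w i * (H *ᵥ w) i := by
    rw [mulVec, dotProduct, Finset.mul_sum]
    exact Finset.sum_congr rfl fun j _ => by ring
  rw [h, mulVec_add, Pi.add_apply, Pi.add_apply]
  ring

/-- SURE: Let p ∈ ℝ^{n+1}, w a random vector with E[w] = 0 and E[wwᵀ] = σ²I,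
y = p + w, and H any fixed (n+1)×(n+1) real matrix.  Then
E[‖Hy − p‖²] = E[‖y − Hy‖² + 2σ²Trace(H) − (n+1)σ²]; i.e.
RSS + 2σ²Trace(H) − (n+1)σ² is an unbiased estimate of the risk E[‖Hy − p‖²]. -/
theorem stmt14 (n : ℕ) (hn : 1 ≤ n)
    {Ω : Type*} [MeasurableSpace Ω] (μ : Measure Ω) [IsProbabilityMeasure μ]
    (σ : ℝ) (p : Fin (n + 1) → ℝ) (w : Ω → Fin (n + 1) → ℝ)
    (H : Matrix (Fin (n + 1)) (Fin (n + 1)) ℝ)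
    (hint1 : ∀ i, Integrable (fun ω => w ω i) μ)
    (hint2 : ∀ i j, Integrable (fun ω => w ω i * w ω j) μ)
    (hmean : ∀ i, ∫ ω, w ω i ∂μ = 0)
    (hcov : ∀ i j, ∫ ω, w ω i * w ω j ∂μ = if i = j then σ ^ 2 else 0) :
    ∫ ω, ∑ i, ((H *ᵥ (p + w ω)) i - p i) ^ 2 ∂μ =
      ∫ ω, (∑ i, ((p + w ω) i - (H *ᵥ (p + w ω)) i) ^ 2 +
        2 * σ ^ 2 * H.trace - ((n : ℝ) + 1) * σ ^ 2) ∂μ := by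
  have hw : ∀ i, MemLp (fun ω => w ω i) 2 μ := fun i =>
    (memLp_two_iff_integrable_sq (hint1 i).aestronglyMeasurable).2 (by
      simpa only [sq] using hint2 i i)
  have hy : ∀ i, MemLp (fun ω => (p + w ω) i) 2 μ := fun i => (memLp_const (p i)).add (hw i)
  have hrss : Integrable (fun ω => ∑ i, ((p + w ω) i - (H *ᵥ (p + w ω)) i) ^ 2) μ :=
    integrable_finsetSum _ fun i _ => ((hy i).sub (memLp_mulVec_apply hy H i)).integrable_sq
  have hlin : ∀ i, Integrable (fun ω => 2 * ((H *ᵥ p) i - p i) * w ω i) μ := fun i =>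
    (hint1 i).const_mul _
  have hquad : ∀ i j, Integrable (fun ω => 2 * H i j * (w ω i * w ω j)) μ := fun i j =>
    (hint2 i j).const_mul _
  have hsum : ∀ i, Integrable (fun ω => ∑ j, 2 * H i j * (w ω i * w ω j)) μ := fun i =>
    integrable_finsetSum _ fun j _ => hquad i j
  have hadd : ∀ i, Integrable (fun ω => 2 * ((H *ᵥ p) i - p i) * w ω i +
      ∑ j, 2 * H i j * (w ω i * w ω j)) μ := fun i => (hlin i).add (hsum i)
  have hterm : ∀ i, Integrable (fun ω => 2 * ((H *ᵥ p) i - p i) * w ω i +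
      ∑ j, 2 * H i j * (w ω i * w ω j) - w ω i * w ω i) μ := fun i =>
    (hadd i).sub (hint2 i i)
  have hval : ∀ i, ∫ ω, (2 * ((H *ᵥ p) i - p i) * w ω i +
      ∑ j, 2 * H i j * (w ω i * w ω j) - w ω i * w ω i) ∂μ = 2 * σ ^ 2 * H i i - σ ^ 2 := by
    intro i
    rw [integral_sub (hadd i) (hint2 i i), integral_add (hlin i) (hsum i),
      integral_finsetSum _ fun j _ => hquad i j]
    simp only [integral_const_mul, hmean, hcov, mul_ite, mul_zero, Finset.sum_ite_eq,
      Finset.mem_univ, if_true]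
    ring
  simp only [sum_sq_mulVec_sub_eq]
  rw [integral_add hrss (integrable_finsetSum _ fun i _ => hterm i),
    integral_finsetSum _ fun i _ => hterm i]
  simp only [hval]
  simp only [add_sub_assoc]
  rw [integral_add hrss (integrable_const _), Finset.sum_sub_distrib, ← Finset.mul_sum]
  simp [trace]
end

section
/- Let P be an (n+3)×(n+3) symmetric positive semidefinite real matrix, λ > 0, y ∈ ℝ^{n+1}, and let Π be the (n+1)×(n+3) matrix with Π(x_1,...,x_{n+3})ᵀ = (x_2,...,x_{n+2})ᵀ. Then the function x ∈ ℝ^{n+3} ↦ λ xᵀ P x + ‖y − Π x‖² has a unique minimizer if and only if the 2×2 submatrix [[P_{1,1}, P_{1,n+3}],[P_{n+3,1}, P_{n+3,n+3}]] is invertible; in that case λP + ΠᵀΠ is invertible and the unique minimizer is x̂ = (λP + ΠᵀΠ)^{-1} Πᵀ y. -/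
open Matrix

/-- The (n+1)×(n+3) matrix Π with Π(x₁,...,x_{n+3})ᵀ = (x₂,...,x_{n+2})ᵀ. -/
def PiMat (n : ℕ) : Matrix (Fin (n + 1)) (Fin (n + 3)) ℝ :=
  Matrix.of fun i j => if (j : ℕ) = (i : ℕ) + 1 then 1 else 0

/-- The objective function x ↦ λ xᵀPx + ‖y − Πx‖² (Euclidean norm squared). -/
noncomputable def obj16 (n : ℕ) (P : Matrix (Fin (n + 3)) (Fin (n + 3)) ℝ) (lam : ℝ)
    (y : Fin (n + 1) → ℝ) (x : Fin (n + 3) → ℝ) : ℝ :=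
  lam * (x ⬝ᵥ (P *ᵥ x)) + ∑ i, (y i - (PiMat n *ᵥ x) i) ^ 2

theorem PiMat_mulVec_apply (n : ℕ) (x : Fin (n + 3) → ℝ) (i : Fin (n + 1)) :
    (PiMat n *ᵥ x) i = x i.succ.castSucc := by
  rw [Matrix.mulVec, dotProduct, Finset.sum_eq_single i.succ.castSucc]
  · simp [PiMat]
  · intro j _ hj
    have : (j : ℕ) ≠ (i : ℕ) + 1 := fun h => hj (Fin.ext (by simpa using h))
    simp [PiMat, this]
  · simp

theorem PiMat_mulVec_single_add_single (n : ℕ) (a b : ℝ) :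
    PiMat n *ᵥ (Pi.single 0 a + Pi.single (Fin.last (n + 2)) b) = 0 := by
  ext i
  have h0 : i.succ.castSucc ≠ (0 : Fin (n + 3)) := Fin.castSucc_ne_zero_iff.mpr (Fin.succ_ne_zero i)
  have h1 : i.succ.castSucc ≠ Fin.last (n + 2) := (Fin.castSucc_lt_last _).ne
  rw [PiMat_mulVec_apply]
  rw [Pi.add_apply, Pi.single_eq_of_ne h0, Pi.single_eq_of_ne h1, add_zero, Pi.zero_apply]

theorem eq_single_add_single_of_PiMat_mulVec_eq_zero {n : ℕ} {x : Fin (n + 3) → ℝ}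
    (hx : PiMat n *ᵥ x = 0) :
    x = Pi.single 0 (x 0) + Pi.single (Fin.last (n + 2)) (x (Fin.last (n + 2))) := by
  ext j
  induction j using Fin.lastCases with
  | last => simp [Fin.ext_iff]
  | cast j =>
    induction j using Fin.cases with
    | zero => simp [Fin.ext_iff]
    | succ i =>
      have h := congrFun hx i
      have h' := congrFun (PiMat_mulVec_single_add_single n (x 0) (x (Fin.last (n + 2)))) i
      rw [PiMat_mulVec_apply] at h h'
      rw [h, h']

theorem mulVec_single_add_single_apply {ι : Type*} [Fintype ι] [DecidableEq ι]
    (P : Matrix ι ι ℝ) (i j k : ι) (a b : ℝ) :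
    (P *ᵥ (Pi.single i a + Pi.single j b)) k = P k i * a + P k j * b := by
  simp [mulVec_add, mul_comm]

/-- The corner submatrix acts as `P` does on vectors supported on the first and last index. -/
theorem corner_mulVec_eq_zero_iff {n : ℕ} {P : Matrix (Fin (n + 3)) (Fin (n + 3)) ℝ}
    (hP : P.PosSemidef) (a b : ℝ) :
    !![P 0 0, P 0 (Fin.last (n + 2));
       P (Fin.last (n + 2)) 0, P (Fin.last (n + 2)) (Fin.last (n + 2))] *ᵥ ![a, b] = 0 ↔
      P *ᵥ (Pi.single 0 a + Pi.single (Fin.last (n + 2)) b) = 0 := by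
  constructor
  · intro h
    have h0 := congrFun h 0
    have h1 := congrFun h 1
    simp [mulVec, dotProduct, Fin.sum_univ_two] at h0 h1
    rw [← hP.dotProduct_mulVec_zero_iff, star_trivial, add_dotProduct, single_dotProduct,
      single_dotProduct, mulVec_single_add_single_apply, mulVec_single_add_single_apply, h0, h1]
    simp
  · intro h
    have h0 := congrFun h 0
    have h1 := congrFun h (Fin.last (n + 2))
    rw [mulVec_single_add_single_apply] at h0 h1
    ext k
    fin_cases k
    · simpa [mulVec, dotProduct, Fin.sum_univ_two] using h0
    · simpa [mulVec, dotProduct, Fin.sum_univ_two] using h1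

theorem obj16_add (n : ℕ) {P : Matrix (Fin (n + 3)) (Fin (n + 3)) ℝ} (hP : P.PosSemidef)
    (lam : ℝ) (y : Fin (n + 1) → ℝ) (x d : Fin (n + 3) → ℝ) :
    obj16 n P lam y (x + d) = obj16 n P lam y x +
      2 * (d ⬝ᵥ ((lam • P + (PiMat n)ᵀ * PiMat n) *ᵥ x - (PiMat n)ᵀ *ᵥ y)) +
      d ⬝ᵥ ((lam • P + (PiMat n)ᵀ * PiMat n) *ᵥ d) := by
  have hT : Pᵀ = P := by
    simpa only [IsHermitian, conjTranspose_eq_transpose_of_trivial] using hP.isHermitian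
  have hs : x ⬝ᵥ (P *ᵥ d) = d ⬝ᵥ (P *ᵥ x) := by
    rw [dotProduct_mulVec, ← mulVec_transpose, hT, dotProduct_comm]
  have hPi : ∀ u, d ⬝ᵥ ((PiMat n)ᵀ *ᵥ u) = (PiMat n *ᵥ d) ⬝ᵥ u := fun u => by
    rw [dotProduct_mulVec, vecMul_transpose]
  have hsq : ∀ z, ∑ i, (y i - (PiMat n *ᵥ z) i) ^ 2 =
      (y - PiMat n *ᵥ z) ⬝ᵥ (y - PiMat n *ᵥ z) := fun z => by
    simp [dotProduct, sq]
  simp only [obj16, hsq]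
  simp only [add_mulVec, smul_mulVec, ← mulVec_mulVec, mulVec_add, dotProduct_add,
    add_dotProduct, dotProduct_sub, sub_dotProduct, dotProduct_smul, hPi, hs, smul_eq_mul]
  rw [dotProduct_comm y (PiMat n *ᵥ d), dotProduct_comm (PiMat n *ᵥ x) (PiMat n *ᵥ d)]
  ring

theorem posDef_penalized_of_isUnit_corner {n : ℕ} {P : Matrix (Fin (n + 3)) (Fin (n + 3)) ℝ}
    (hP : P.PosSemidef) {lam : ℝ} (hlam : 0 < lam)
    (hB : IsUnit !![P 0 0, P 0 (Fin.last (n + 2));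
      P (Fin.last (n + 2)) 0, P (Fin.last (n + 2)) (Fin.last (n + 2))]) :
    (lam • P + (PiMat n)ᵀ * PiMat n).PosDef := by
  have hPi : ((PiMat n)ᵀ * PiMat n).PosSemidef := by
    simpa only [conjTranspose_eq_transpose_of_trivial] using posSemidef_conjTranspose_mul_self (PiMat n)
  refine .of_dotProduct_mulVec_pos ((hP.smul hlam.le).add hPi).isHermitian fun {v} hv => ?_
  have h1 := hP.dotProduct_mulVec_nonneg v
  have h2 : v ⬝ᵥ (((PiMat n)ᵀ * PiMat n) *ᵥ v) = (PiMat n *ᵥ v) ⬝ᵥ (PiMat n *ᵥ v) := by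
    rw [← mulVec_mulVec, dotProduct_mulVec, vecMul_transpose]
  have h3 : 0 ≤ (PiMat n *ᵥ v) ⬝ᵥ (PiMat n *ᵥ v) :=
    Finset.sum_nonneg fun i _ => mul_self_nonneg _
  simp only [star_trivial] at h1 ⊢
  rw [add_mulVec, smul_mulVec, dotProduct_add, dotProduct_smul, h2, smul_eq_mul]
  have h4 := mul_nonneg hlam.le h1
  by_contra hneg
  have hPi0 : PiMat n *ᵥ v = 0 := dotProduct_self_eq_zero.mp (by linarith)
  have hP0 : P *ᵥ v = 0 := by
    rw [← hP.dotProduct_mulVec_zero_iff, star_trivial]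
    have : lam * (v ⬝ᵥ P *ᵥ v) = 0 := by linarith
    exact (mul_eq_zero.mp this).resolve_left hlam.ne'
  have hv' := eq_single_add_single_of_PiMat_mulVec_eq_zero hPi0
  rw [hv', ← corner_mulVec_eq_zero_iff hP] at hP0
  have h0 := mulVec_injective_of_isUnit hB (hP0.trans (mulVec_zero _).symm)
  apply hv
  rw [hv', show v 0 = 0 from congrFun h0 0, show v (Fin.last (n + 2)) = 0 from congrFun h0 1]
  simp

/-- Let P be (n+3)×(n+3) symmetric positive semidefinite, λ > 0, y ∈ ℝ^{n+1}.
Then x ↦ λxᵀPx + ‖y − Πx‖² has a unique minimizer iff the 2×2 submatrix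
[[P₁₁, P₁,ₙ₊₃],[Pₙ₊₃,₁, Pₙ₊₃,ₙ₊₃]] is invertible; in that case λP + ΠᵀΠ is invertible and
the unique minimizer is x̂ = (λP + ΠᵀΠ)⁻¹Πᵀy. -/
theorem stmt16 (n : ℕ) (hn : 1 ≤ n)
    (P : Matrix (Fin (n + 3)) (Fin (n + 3)) ℝ) (hP : P.PosSemidef)
    (lam : ℝ) (hlam : 0 < lam) (y : Fin (n + 1) → ℝ) :
    ((∃! x : Fin (n + 3) → ℝ, ∀ z, obj16 n P lam y x ≤ obj16 n P lam y z) ↔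
      IsUnit !![P 0 0, P 0 (Fin.last (n + 2));
                P (Fin.last (n + 2)) 0, P (Fin.last (n + 2)) (Fin.last (n + 2))]) ∧
    (IsUnit !![P 0 0, P 0 (Fin.last (n + 2));
               P (Fin.last (n + 2)) 0, P (Fin.last (n + 2)) (Fin.last (n + 2))] →
      IsUnit (lam • P + (PiMat n)ᵀ * PiMat n) ∧
      (∀ z, obj16 n P lam y ((lam • P + (PiMat n)ᵀ * PiMat n)⁻¹ *ᵥ ((PiMat n)ᵀ *ᵥ y)) ≤
        obj16 n P lam y z) ∧
      (∀ x : Fin (n + 3) → ℝ, (∀ z, obj16 n P lam y x ≤ obj16 n P lam y z) →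
        x = (lam • P + (PiMat n)ᵀ * PiMat n)⁻¹ *ᵥ ((PiMat n)ᵀ *ᵥ y))) := by
  have hmin : IsUnit !![P 0 0, P 0 (Fin.last (n + 2));
      P (Fin.last (n + 2)) 0, P (Fin.last (n + 2)) (Fin.last (n + 2))] →
      IsUnit (lam • P + (PiMat n)ᵀ * PiMat n) ∧
      (∀ z, obj16 n P lam y ((lam • P + (PiMat n)ᵀ * PiMat n)⁻¹ *ᵥ ((PiMat n)ᵀ *ᵥ y)) ≤
        obj16 n P lam y z) ∧
      (∀ x : Fin (n + 3) → ℝ, (∀ z, obj16 n P lam y x ≤ obj16 n P lam y z) →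
        x = (lam • P + (PiMat n)ᵀ * PiMat n)⁻¹ *ᵥ ((PiMat n)ᵀ *ᵥ y)) := by
    intro hB
    have hM := posDef_penalized_of_isUnit_corner hP hlam hB
    set M := lam • P + (PiMat n)ᵀ * PiMat n with hMdef
    set xhat := M⁻¹ *ᵥ ((PiMat n)ᵀ *ᵥ y) with hxhat
    have hx : M *ᵥ xhat - (PiMat n)ᵀ *ᵥ y = 0 := by
      rw [hxhat, mulVec_mulVec, mul_nonsing_inv _ ((isUnit_iff_isUnit_det _).mp hM.isUnit),
        one_mulVec, sub_self]
    have key : ∀ z, obj16 n P lam y z =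
        obj16 n P lam y xhat + (z - xhat) ⬝ᵥ (M *ᵥ (z - xhat)) := fun z => by
      have h := obj16_add n hP lam y xhat (z - xhat)
      rwa [← hMdef, hx, dotProduct_zero, mul_zero, add_zero, add_sub_cancel] at h
    refine ⟨hM.isUnit, fun z => ?_, fun x hxmin => ?_⟩
    · have h := hM.posSemidef.dotProduct_mulVec_nonneg (z - xhat)
      rw [star_trivial] at h
      linarith [key z]
    · by_contra hne
      have h := hM.dotProduct_mulVec_pos (sub_ne_zero.mpr hne)
      rw [star_trivial] at h
      linarith [key x, hxmin xhat]
  refine ⟨⟨?_, fun hB => ⟨_, (hmin hB).2.1, (hmin hB).2.2⟩⟩, hmin⟩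
  rintro ⟨x, hx, huniq⟩
  rw [← mulVec_injective_iff_isUnit, ← coe_mulVecLin, injective_iff_map_eq_zero]
  intro w hw
  have hw2 : w = ![w 0, w 1] := by
    ext i
    fin_cases i <;> rfl
  rw [mulVecLin_apply, hw2, corner_mulVec_eq_zero_iff hP] at hw
  have hPi0 := PiMat_mulVec_single_add_single n (w 0) (w 1)
  set v : Fin (n + 3) → ℝ := Pi.single 0 (w 0) + Pi.single (Fin.last (n + 2)) (w 1) with hv
  have hobj : obj16 n P lam y (x + v) = obj16 n P lam y x := by
    simp only [obj16, mulVec_add, hw, hPi0, add_zero, add_dotProduct]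
    have hT : Pᵀ = P := by
      simpa only [IsHermitian, conjTranspose_eq_transpose_of_trivial] using hP.isHermitian
    rw [dotProduct_mulVec v, ← mulVec_transpose, hT, hw, zero_dotProduct, add_zero]
  have hv0 : v = 0 := by
    have h : x + v = x := huniq _ fun z => hobj.trans_le (hx z)
    simpa using h
  have h0 : w 0 = 0 := by simpa [hv, Fin.ext_iff] using congrFun hv0 0
  have h1 : w 1 = 0 := by simpa [hv, Fin.ext_iff] using congrFun hv0 (Fin.last (n + 2))
  rw [hw2, h0, h1]
  simp
end

section
/- Let P be an (n+3)×(n+3) symmetric positive semidefinite real matrix, λ > 0, y ∈ ℝ^{n+1}, and let Π be the (n+1)×(n+3) matrix with Π(x_1,...,x_{n+3})ᵀ = (x_2,...,x_{n+2})ᵀ. Assume the 2×2 submatrix [[P_{1,1}, P_{1,n+3}],[P_{n+3,1}, P_{n+3,n+3}]] is invertible and that P_{1,j} = 0 and P_{n+3,j} = 0 for all j = 2,...,n+2. Then the unique minimizer x̂ of x ↦ λ xᵀ P x + ‖y − Π x‖² satisfies x̂_1 = 0 and x̂_{n+3} = 0; i.e. the nonvanishing of the middle entries of the first or last row of P is necessary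 for the estimator to have û_1 ≠ 0 or û_{n+1} ≠ 0. -/
open Matrix

/-- The objective function x ↦ λ xᵀPx + ‖y − Πx‖² (Euclidean norm squared). -/
noncomputable def obj17 (n : ℕ) (P : Matrix (Fin (n + 3)) (Fin (n + 3)) ℝ) (lam : ℝ)
    (y : Fin (n + 1) → ℝ) (x : Fin (n + 3) → ℝ) : ℝ :=
  lam * (x ⬝ᵥ (P *ᵥ x)) + ∑ i, (y i - (PiMat n *ᵥ x) i) ^ 2

theorem PiMat_transpose_mulVec_zero (n : ℕ) (w : Fin (n + 1) → ℝ) :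
    ((PiMat n)ᵀ *ᵥ w) 0 = 0 := by
  simp [mulVec, dotProduct, PiMat]

theorem PiMat_transpose_mulVec_last (n : ℕ) (w : Fin (n + 1) → ℝ) :
    ((PiMat n)ᵀ *ᵥ w) (Fin.last (n + 2)) = 0 := by
  rw [mulVec, dotProduct]
  refine Finset.sum_eq_zero fun i _ => ?_
  have : n + 2 ≠ (i : ℕ) + 1 := by omega
  simp [PiMat, this]

theorem obj17_eq_dotProduct (n : ℕ) (P : Matrix (Fin (n + 3)) (Fin (n + 3)) ℝ) (lam : ℝ)
    (y : Fin (n + 1) → ℝ) (x : Fin (n + 3) → ℝ) :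
    obj17 n P lam y x =
      lam * (x ⬝ᵥ (P *ᵥ x)) + (y - PiMat n *ᵥ x) ⬝ᵥ (y - PiMat n *ᵥ x) := by
  simp [obj17, dotProduct, pow_two]

/-- Second-order expansion of the objective around a point. -/
theorem obj17_add (n : ℕ) {P : Matrix (Fin (n + 3)) (Fin (n + 3)) ℝ} (hP : Pᵀ = P) (lam : ℝ)
    (y : Fin (n + 1) → ℝ) (x d : Fin (n + 3) → ℝ) :
    obj17 n P lam y (x + d) = obj17 n P lam y x
      + 2 * (d ⬝ᵥ ((lam • P + (PiMat n)ᵀ * PiMat n) *ᵥ x - (PiMat n)ᵀ *ᵥ y))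
      + d ⬝ᵥ ((lam • P + (PiMat n)ᵀ * PiMat n) *ᵥ d) := by
  have hsymm : x ⬝ᵥ (P *ᵥ d) = d ⬝ᵥ (P *ᵥ x) := by
    rw [dotProduct_mulVec, ← mulVec_transpose, hP, dotProduct_comm]
  have hadj (w : Fin (n + 1) → ℝ) : d ⬝ᵥ ((PiMat n)ᵀ *ᵥ w) = (PiMat n *ᵥ d) ⬝ᵥ w := by
    rw [dotProduct_mulVec, vecMul_transpose]
  have hx := dotProduct_comm (PiMat n *ᵥ x) (PiMat n *ᵥ d)
  have hy := dotProduct_comm y (PiMat n *ᵥ d)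
  simp only [obj17_eq_dotProduct, mulVec_add, add_mulVec, smul_mulVec, ← mulVec_mulVec,
    dotProduct_add, add_dotProduct, dotProduct_sub, sub_dotProduct, dotProduct_smul, hadj,
    smul_eq_mul]
  linear_combination lam * hsymm + hx - hy

/-- If the first and last rows of `P` vanish off the corners and the corner block is invertible,
then the end entries of `x` vanish as soon as those of `P *ᵥ x` do. -/
theorem end_entries_eq_zero {n : ℕ} {P : Matrix (Fin (n + 3)) (Fin (n + 3)) ℝ}
    (hQ : IsUnit !![P 0 0, P 0 (Fin.last (n + 2));
                    P (Fin.last (n + 2)) 0, P (Fin.last (n + 2)) (Fin.last (n + 2))])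
    (hzero : ∀ j : Fin (n + 3), j ≠ 0 → j ≠ Fin.last (n + 2) →
      P 0 j = 0 ∧ P (Fin.last (n + 2)) j = 0)
    {x : Fin (n + 3) → ℝ} (h0 : (P *ᵥ x) 0 = 0) (hl : (P *ᵥ x) (Fin.last (n + 2)) = 0) :
    x 0 = 0 ∧ x (Fin.last (n + 2)) = 0 := by
  have hne : (0 : Fin (n + 3)) ≠ Fin.last (n + 2) := (Fin.last_pos).ne
  rw [mulVec, dotProduct, Fintype.sum_eq_add 0 (Fin.last (n + 2)) hne
    fun j hj => by rw [(hzero j hj.1 hj.2).1, zero_mul]] at h0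
  rw [mulVec, dotProduct, Fintype.sum_eq_add 0 (Fin.last (n + 2)) hne
    fun j hj => by rw [(hzero j hj.1 hj.2).2, zero_mul]] at hl
  have hv : ![x 0, x (Fin.last (n + 2))] = 0 := by
    apply mulVec_injective_of_isUnit hQ
    ext i
    fin_cases i
    · simpa [mulVec, dotProduct] using h0
    · simpa [mulVec, dotProduct] using hl
  exact ⟨congrFun hv 0, congrFun hv 1⟩

theorem posDef_smul_add_PiMat {n : ℕ} {P : Matrix (Fin (n + 3)) (Fin (n + 3)) ℝ}
    (hP : P.PosSemidef) {lam : ℝ} (hlam : 0 < lam)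
    (hQ : IsUnit !![P 0 0, P 0 (Fin.last (n + 2));
                    P (Fin.last (n + 2)) 0, P (Fin.last (n + 2)) (Fin.last (n + 2))])
    (hzero : ∀ j : Fin (n + 3), j ≠ 0 → j ≠ Fin.last (n + 2) →
      P 0 j = 0 ∧ P (Fin.last (n + 2)) j = 0) :
    (lam • P + (PiMat n)ᵀ * PiMat n).PosDef := by
  have hG : ((PiMat n)ᵀ * PiMat n).PosSemidef := by
    simpa using posSemidef_conjTranspose_mul_self (PiMat n)
  have hM := (hP.smul hlam.le).add hG
  refine .of_dotProduct_mulVec_pos hM.isHermitian fun x hx => ?_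
  refine (hM.dotProduct_mulVec_nonneg x).lt_of_ne' fun h => hx ?_
  have hPx := hP.dotProduct_mulVec_nonneg x
  have hGx := hG.dotProduct_mulVec_nonneg x
  simp only [add_mulVec, smul_mulVec, dotProduct_add, dotProduct_smul, smul_eq_mul] at h
  have hPx0 : star x ⬝ᵥ (P *ᵥ x) = 0 := by nlinarith
  have hGx0 : star x ⬝ᵥ (((PiMat n)ᵀ * PiMat n) *ᵥ x) = 0 := by nlinarith
  rw [hP.dotProduct_mulVec_zero_iff] at hPx0
  have hmid : PiMat n *ᵥ x = 0 := by
    rwa [← mulVec_mulVec, dotProduct_mulVec, vecMul_transpose, star_trivial,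
      dotProduct_self_eq_zero] at hGx0
  obtain ⟨h0, hl⟩ := end_entries_eq_zero hQ hzero (congrFun hPx0 0) (congrFun hPx0 _)
  ext j
  induction j using Fin.lastCases with
  | last => exact hl
  | cast j =>
    induction j using Fin.cases with
    | zero => exact h0
    | succ i => simpa [hmid] using (PiMat_mulVec_apply n x i).symm

/-- Let P be (n+3)×(n+3) symmetric positive semidefinite, λ > 0, y ∈ ℝ^{n+1},
with the 2×2 corner submatrix invertible and P_{1,j} = 0, P_{n+3,j} = 0 for all
j = 2,...,n+2.  Then the unique minimizer x̂ of x ↦ λxᵀPx + ‖y − Πx‖² satisfies x̂₁ = 0 and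
x̂_{n+3} = 0 (the nonvanishing of the middle entries of the first or last row of P is
necessary for û₁ ≠ 0 or û_{n+1} ≠ 0). -/
theorem stmt17 (n : ℕ) (hn : 1 ≤ n)
    (P : Matrix (Fin (n + 3)) (Fin (n + 3)) ℝ) (hP : P.PosSemidef)
    (lam : ℝ) (hlam : 0 < lam) (y : Fin (n + 1) → ℝ)
    (hQ : IsUnit !![P 0 0, P 0 (Fin.last (n + 2));
                    P (Fin.last (n + 2)) 0, P (Fin.last (n + 2)) (Fin.last (n + 2))])
    (hzero : ∀ j : Fin (n + 3), j ≠ 0 → j ≠ Fin.last (n + 2) →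
      P 0 j = 0 ∧ P (Fin.last (n + 2)) j = 0) :
    (∃ x : Fin (n + 3) → ℝ, ∀ z, obj17 n P lam y x ≤ obj17 n P lam y z) ∧
    (∀ x : Fin (n + 3) → ℝ, (∀ z, obj17 n P lam y x ≤ obj17 n P lam y z) →
      x 0 = 0 ∧ x (Fin.last (n + 2)) = 0) := by
  have hT : Pᵀ = P := by simpa [IsHermitian] using hP.isHermitian
  have hM := posDef_smul_add_PiMat hP hlam hQ hzero
  obtain ⟨x₀, hx₀⟩ := mulVec_surjective_iff_isUnit.mpr hM.isUnit ((PiMat n)ᵀ *ᵥ y)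
  have hexp (z : Fin (n + 3) → ℝ) : obj17 n P lam y z = obj17 n P lam y x₀
      + (z - x₀) ⬝ᵥ ((lam • P + (PiMat n)ᵀ * PiMat n) *ᵥ (z - x₀)) := by
    simpa [hx₀] using obj17_add n hT lam y x₀ (z - x₀)
  refine ⟨⟨x₀, fun z => ?_⟩, fun x hx => ?_⟩
  · rw [hexp z]
    simpa using hM.posSemidef.dotProduct_mulVec_nonneg (z - x₀)
  · have hxx₀ : x = x₀ := by
      by_contra hne
      have hpos := hM.dotProduct_mulVec_pos (sub_ne_zero.mpr hne)
      have hle := hx x₀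
      rw [hexp x] at hle
      rw [star_trivial] at hpos
      linarith
    subst hxx₀
    simp only [add_mulVec, smul_mulVec, ← mulVec_mulVec] at hx₀
    apply end_entries_eq_zero hQ hzero
    · simpa [PiMat_transpose_mulVec_zero, hlam.ne', -mulVec_mulVec] using congrFun hx₀ 0
    · simpa [PiMat_transpose_mulVec_last, hlam.ne', -mulVec_mulVec]
        using congrFun hx₀ (Fin.last (n + 2))
end
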